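/- arXiv:2502.02058 — 2 statements merged into one kernel-verified Lean document; each statement's English description precedes it below -/
import Mathlib

section
/- If v is a solenoidal symmetric m-tensor field (δv = 0) with Schwartz components, then for every ℓ ≥ 0 one has δ^{ℓ+1} d^ℓ v = 0; in particular δ^ℓ d^ℓ v is solenoidal. -/
open MeasureTheory
open scoped RealInnerProductSpace
noncomputable section

abbrev E (n : ℕ) := EuclideanSpace ℝ (Fin n)

/-- Tensor field of order `m` on ℝⁿ, given by its components. -/
abbrev TF (n m : ℕ) := E n → (Fin m → Fin n) → ℝ

/-- Partial derivative in the `i`-th coordinate direction. -/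
def pd {n : ℕ} (i : Fin n) (g : E n → ℝ) (x : E n) : ℝ :=
  fderiv ℝ g x (EuclideanSpace.single i 1)

/-- All components of the tensor field are Schwartz functions. -/
def IsSchwartzTF {n m : ℕ} (f : TF n m) : Prop :=
  ∀ idx, ∃ g : SchwartzMap (E n) ℝ, (fun x => f x idx) = ⇑g

/-- The tensor field is symmetric. -/
def IsSymTF {n m : ℕ} (f : TF n m) : Prop :=
  ∀ (x : E n) (σ : Equiv.Perm (Fin m)) (idx : Fin m → Fin n), f x (idx ∘ σ) = f x idx

/-- Divergence δ of a tensor field (contraction of the derivative in the last index). -/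
def div' {n m : ℕ} : TF n m → TF n (m - 1) :=
  match m with
  | 0 => fun _ => fun _ _ => 0
  | _ + 1 => fun u x idx => ∑ i : Fin n, pd i (fun y => u y (Fin.snoc idx i)) x

/-- Iterated divergence δ^k. -/
def divIter {n m : ℕ} : (k : ℕ) → TF n m → TF n (m - k)
  | 0, u => u
  | k + 1, u => div' (divIter k u)

/-- Symmetrization of an `m`-tensor (average over permutations of the indices). -/
def symz {n m : ℕ} (T : (Fin m → Fin n) → ℝ) : (Fin m → Fin n) → ℝ :=
  fun idx => (m.factorial : ℝ)⁻¹ * ∑ σ : Equiv.Perm (Fin m), T (idx ∘ σ)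

/-- Symmetrized derivative (inner differentiation) d. -/
def dsym {n m : ℕ} (v : TF n m) : TF n (m + 1) :=
  fun x => symz (fun idx => pd (idx (Fin.last m)) (fun y => v y (idx ∘ Fin.castSucc)) x)

/-- Iterated symmetrized derivative d^k. -/
def dIter {n m : ℕ} : (k : ℕ) → TF n m → TF n (m + k)
  | 0, v => v
  | k + 1, v => dsym (dIter k v)

/-- Componentwise Laplacian. -/
def lap {n m : ℕ} (u : TF n m) : TF n m :=
  fun x idx => ∑ i : Fin n, pd i (fun y => pd i (fun z => u z idx) y) x

/-- Full contraction of an `m`-tensor field with a family of `m` vectors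
(equivalently, with the symmetric product of those vectors when the field is symmetric). -/
def contr {n m : ℕ} (f : TF n m) (v : Fin m → E n) (x : E n) : ℝ :=
  ∑ idx : Fin m → Fin n, f x idx * ∏ j, v j (idx j)

/-- Contraction with a vector `w` in the last index. -/
def jv {n m : ℕ} (w : E n) : TF n m → TF n (m - 1) :=
  match m with
  | 0 => fun _ => fun _ _ => 0
  | _ + 1 => fun u x idx => ∑ i : Fin n, w i * u x (Fin.snoc idx i)

/-- Iterated contraction with `w` in the last `k` indices. -/
def jvIter {n m : ℕ} (w : E n) : (k : ℕ) → TF n m → TF n (m - k)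
  | 0, u => u
  | k + 1, u => jv w (jvIter w k u)

/-- Integral of a scalar function over the hyperplane `{x : ⟪x, ω⟫ = p}`. -/
def hypInt {n : ℕ} (h : E n → ℝ) (ω : E n) (p : ℝ) : ℝ :=
  ∫ y : ((ℝ ∙ ω)ᗮ : Submodule ℝ (E n)), h (p • ω + (y : E n))

/-- The transversal Radon transform 𝒯^m of a symmetric m-tensor field. -/
def TRT {n m : ℕ} (g : TF n m) (ω : E n) (p : ℝ) : ℝ :=
  hypInt (contr g (fun _ => ω)) ω p

/-! ### Scalar lemmas -/

abbrev Sm {n : ℕ} (g : E n → ℝ) : Prop := ContDiff ℝ (⊤ : ℕ∞) g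

theorem Sm.diff {n : ℕ} {g : E n → ℝ} (hg : Sm g) : Differentiable ℝ g :=
  ContDiff.differentiable hg (by simp)

theorem pd_smooth {n : ℕ} (i : Fin n) {g : E n → ℝ} (hg : Sm g) : Sm (pd i g) := by
  have h : ContDiff ℝ (⊤ : ℕ∞) (fderiv ℝ g) := ContDiff.fderiv_right hg (by simp)
  exact h.clm_apply contDiff_const

theorem pd_comm {n : ℕ} (i j : Fin n) {g : E n → ℝ} (hg : Sm g) :
    pd i (pd j g) = pd j (pd i g) := by
  funext x
  have h : ContDiff ℝ (⊤ : ℕ∞) (fderiv ℝ g) := ContDiff.fderiv_right hg (by simp)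
  have hd : DifferentiableAt ℝ (fderiv ℝ g) x := (h.differentiable (by simp)) x
  have key : ∀ a b : Fin n, pd a (pd b g) x =
      fderiv ℝ (fderiv ℝ g) x (EuclideanSpace.single a 1) (EuclideanSpace.single b 1) := by
    intro a b
    have := (hd.hasFDerivAt.clm_apply (hasFDerivAt_const (EuclideanSpace.single b (1:ℝ)) x)).fderiv
    unfold pd
    rw [this]
    simp
  rw [key, key]
  have hs : IsSymmSndFDerivAt ℝ g x :=
    (ContDiff.contDiffAt hg).isSymmSndFDerivAt (by
      simp only [minSmoothness_of_isRCLikeNormedField]; exact WithTop.coe_le_coe.mpr (le_top : (2 : ℕ∞) ≤ ⊤))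
  exact hs _ _

theorem pd_zero {n : ℕ} (i : Fin n) : pd i (fun _ : E n => (0 : ℝ)) = fun _ => 0 := by
  funext x; simp [pd]

theorem pd_sum {n : ℕ} {ι : Type*} (s : Finset ι) (i : Fin n) (g : ι → E n → ℝ)
    (hg : ∀ k, Sm (g k)) :
    pd i (fun x => ∑ k ∈ s, g k x) = fun x => ∑ k ∈ s, pd i (g k) x := by
  funext x
  unfold pd
  rw [fderiv_fun_sum (fun k _ => (hg k).diff x)]
  simp

theorem pd_mul {n : ℕ} (i : Fin n) (c : ℝ) {g : E n → ℝ} (hg : Sm g) :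
    pd i (fun x => c * g x) = fun x => c * pd i g x := by
  funext x
  unfold pd
  rw [fderiv_const_mul (hg.diff x)]
  simp

/-- scalar Laplacian -/
def slap {n : ℕ} (g : E n → ℝ) : E n → ℝ := fun x => ∑ i : Fin n, pd i (pd i g) x

theorem slap_smooth {n : ℕ} {g : E n → ℝ} (hg : Sm g) : Sm (slap g) :=
  ContDiff.sum (fun i _ => pd_smooth i (pd_smooth i hg))

theorem pd_slap {n : ℕ} (j : Fin n) {g : E n → ℝ} (hg : Sm g) :
    pd j (slap g) = slap (pd j g) := by
  unfold slap
  rw [pd_sum _ _ _ (fun i => pd_smooth i (pd_smooth i hg))]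
  funext x
  refine Finset.sum_congr rfl (fun i _ => ?_)
  rw [pd_comm j i (pd_smooth i hg), pd_comm j i hg]

theorem slap_sum {n : ℕ} {ι : Type*} (s : Finset ι) (g : ι → E n → ℝ)
    (hg : ∀ k, Sm (g k)) :
    slap (fun x => ∑ k ∈ s, g k x) = fun x => ∑ k ∈ s, slap (g k) x := by
  unfold slap
  funext x
  rw [Finset.sum_comm]
  refine Finset.sum_congr rfl (fun i _ => ?_)
  rw [pd_sum _ _ _ hg, pd_sum _ _ _ (fun k => pd_smooth i (hg k))]

theorem slap_mul {n : ℕ} (c : ℝ) {g : E n → ℝ} (hg : Sm g) :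
    slap (fun x => c * g x) = fun x => c * slap g x := by
  unfold slap
  funext x
  rw [Finset.mul_sum]
  refine Finset.sum_congr rfl (fun i _ => ?_)
  rw [pd_mul _ _ hg, pd_mul _ _ (pd_smooth i hg)]

/-! ### Tensor lemmas -/

def SmTF {n m : ℕ} (u : TF n m) : Prop := ∀ idx, Sm (fun x => u x idx)

theorem lap_eq {n m : ℕ} (u : TF n m) (x : E n) (idx : Fin m → Fin n) :
    lap u x idx = slap (fun z => u z idx) x := rfl

theorem div_smooth {n m : ℕ} {u : TF n m} (hu : SmTF u) : SmTF (div' u) := by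
  cases m with
  | zero => intro idx; exact contDiff_const
  | succ m => intro idx; exact ContDiff.sum (fun i _ => pd_smooth i (hu _))

theorem divIter_smooth {n m : ℕ} {u : TF n m} (hu : SmTF u) (k : ℕ) : SmTF (divIter k u) := by
  induction k with
  | zero => exact hu
  | succ k ih => exact div_smooth ih

theorem dsym_smooth {n m : ℕ} {u : TF n m} (hu : SmTF u) : SmTF (dsym u) := by
  intro idx
  exact contDiff_const.mul (ContDiff.sum (fun σ _ => pd_smooth _ (hu _)))

theorem dIter_smooth {n m : ℕ} {u : TF n m} (hu : SmTF u) (k : ℕ) : SmTF (dIter k u) := by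
  induction k with
  | zero => exact hu
  | succ k ih => exact dsym_smooth ih

theorem dsym_sym {n m : ℕ} (u : TF n m) : IsSymTF (dsym u) := by
  intro x σ idx
  unfold dsym symz
  dsimp only
  congr 1
  exact Fintype.sum_equiv (Equiv.mulLeft σ) _ _ (fun τ => rfl)

theorem dIter_sym {n m : ℕ} {u : TF n m} (hu : IsSymTF u) (k : ℕ) : IsSymTF (dIter k u) := by
  cases k with
  | zero => exact hu
  | succ k => exact dsym_sym _

theorem div_lap {n m : ℕ} {u : TF n m} (hu : SmTF u) (c : ℝ) :
    div' (fun x idx => c * lap u x idx) = fun x idx => c * lap (div' u) x idx := by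
  cases m with
  | zero =>
    funext x idx
    simp [div', lap, pd_zero]
  | succ m =>
    funext x idx
    rw [lap_eq]
    change ∑ i : Fin n, pd i (fun y => c * slap (fun z => u z (Fin.snoc idx i)) y) x =
      c * slap (fun y => ∑ i : Fin n, pd i (fun y => u y (Fin.snoc idx i)) y) x
    rw [slap_sum _ _ (fun i => pd_smooth i (hu _)), Finset.mul_sum]
    refine Finset.sum_congr rfl (fun i _ => ?_)
    rw [pd_mul _ _ (slap_smooth (hu _)), pd_slap _ (hu _)]

theorem divIter_lap {n m : ℕ} {u : TF n m} (hu : SmTF u) (c : ℝ) (k : ℕ) :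
    divIter k (fun x idx => c * lap u x idx) = fun x idx => c * lap (divIter k u) x idx := by
  induction k with
  | zero => rfl
  | succ k ih =>
    change div' (divIter k _) = _
    rw [ih, div_lap (divIter_smooth hu k)]
    rfl

theorem div_heq {n a b : ℕ} (h : a = b) (u : TF n a) (w : TF n b) (huw : HEq u w) :
    HEq (div' u) (div' w) := by
  subst h; cases huw; rfl

theorem divIter_heq {n m : ℕ} (u : TF n m) (k : ℕ) :
    HEq (divIter (k + 1) u) (divIter k (div' u)) := by
  induction k with
  | zero => exact HEq.rfl
  | succ k ih => exact div_heq (show m - (k + 1) = m - 1 - k by omega) _ _ ih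

theorem zero_of_heq {n a b : ℕ} (h : a = b) (u : TF n a) (w : TF n b) (huw : HEq u w)
    (hw : w = fun _ _ => 0) : u = fun _ _ => 0 := by
  subst h; cases huw; exact hw

theorem sym_inj {n m : ℕ} {u : TF n m} (hu : IsSymTF u) (x : E n) (idx : Fin (m + 1) → Fin n)
    (σ : Equiv.Perm (Fin (m + 1))) :
    u x ((idx ∘ σ) ∘ Fin.castSucc) = u x (idx ∘ (σ (Fin.last m)).succAbove) := by
  have hex : ∀ j : Fin m, ∃ z, (σ (Fin.last m)).succAbove z = σ j.castSucc := by
    intro j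
    apply Fin.exists_succAbove_eq
    intro h
    exact (Fin.castSucc_lt_last j).ne (σ.injective h)
  choose τ hτ using hex
  have hinj : Function.Injective τ := by
    intro a b hab
    have : σ a.castSucc = σ b.castSucc := by rw [← hτ, ← hτ, hab]
    exact Fin.castSucc_injective _ (σ.injective this)
  have hb : Function.Bijective τ := Finite.injective_iff_bijective.mp hinj
  rw [← hu x (Equiv.ofBijective τ hb) (idx ∘ (σ (Fin.last m)).succAbove)]
  congr 1
  funext j
  simp [hτ]

theorem sum_perm {m : ℕ} (g : Fin (m + 1) → ℝ) :
    ∑ σ : Equiv.Perm (Fin (m + 1)), g (σ (Fin.last m)) = (m.factorial : ℝ) * ∑ k, g k := by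
  have h1 : ∑ σ : Equiv.Perm (Fin (m + 1)), g (σ (Fin.last m)) =
      ∑ σ : Equiv.Perm (Fin (m + 1)), g (σ 0) :=
    Fintype.sum_equiv (Equiv.mulRight (Equiv.swap 0 (Fin.last m))) _ _ (fun τ => by simp)
  rw [h1, ← Equiv.sum_comp (Equiv.Perm.decomposeFin (n := m)).symm, Fintype.sum_prod_type]
  simp [Fintype.card_perm, Finset.mul_sum]

theorem dsym_eq {n m : ℕ} {u : TF n m} (hu : IsSymTF u) (x : E n) (idx : Fin (m + 1) → Fin n) :
    dsym u x idx = ((m : ℝ) + 1)⁻¹ *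
      ∑ k : Fin (m + 1), pd (idx k) (fun y => u y (idx ∘ k.succAbove)) x := by
  unfold dsym symz
  have : ∀ σ : Equiv.Perm (Fin (m + 1)),
      pd ((idx ∘ σ) (Fin.last m)) (fun y => u y ((idx ∘ σ) ∘ Fin.castSucc)) x =
      (fun k => pd (idx k) (fun y => u y (idx ∘ k.succAbove)) x) (σ (Fin.last m)) := by
    intro σ
    simp only [sym_inj hu]
    rfl
  rw [Finset.sum_congr rfl (fun σ _ => this σ),
    sum_perm (fun k => pd (idx k) (fun y => u y (idx ∘ k.succAbove)) x), ← mul_assoc]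
  congr 1
  rw [Nat.factorial_succ]
  have := Nat.factorial_ne_zero m
  push_cast
  field_simp

theorem snoc_succAbove {n m : ℕ} (idx : Fin (m + 1) → Fin n) (i : Fin n) (j : Fin (m + 1)) :
    (Fin.snoc idx i : Fin (m + 2) → Fin n) ∘ (j.castSucc).succAbove =
      (Fin.snoc (idx ∘ j.succAbove) i : Fin (m + 1) → Fin n) := by
  funext k
  refine Fin.lastCases ?_ (fun k => ?_) k
  · simp
  · simp only [Function.comp_apply, Fin.castSucc_succAbove_castSucc, Fin.snoc_castSucc]

theorem div_dsym {n m : ℕ} {u : TF n (m + 1)} (hs : SmTF u) (hu : IsSymTF u) (x : E n)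
    (idx : Fin (m + 1) → Fin n) :
    div' (dsym u) x idx = ((m : ℝ) + 2)⁻¹ * (lap u x idx +
      ∑ j : Fin (m + 1), pd (idx j) (fun y => div' u y (idx ∘ j.succAbove)) x) := by
  change ∑ i : Fin n, pd i (fun y => dsym u y (Fin.snoc idx i)) x = _
  have h1 : ∀ i : Fin n, pd i (fun y => dsym u y (Fin.snoc idx i)) x =
      ((m : ℝ) + 2)⁻¹ * (pd i (pd i (fun y => u y idx)) x +
        ∑ j : Fin (m + 1), pd (idx j) (pd i (fun y => u y (Fin.snoc (idx ∘ j.succAbove) i))) x) := by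
    intro i
    simp only [dsym_eq hu]
    rw [pd_mul _ _ (ContDiff.sum (fun k _ => pd_smooth _ (hs _))),
      pd_sum _ _ _ (fun k => pd_smooth _ (hs _))]
    dsimp only
    rw [Fin.sum_univ_castSucc, add_comm (Finset.sum _ _)]
    have e : (((m + 1 : ℕ) : ℝ) + 1) = (m : ℝ) + 2 := by push_cast; ring
    rw [e]
    congr 2
    · have : (Fin.snoc idx i : Fin (m + 2) → Fin n) ∘ (Fin.last (m + 1)).succAbove = idx := by
        funext k; simp
      rw [this]; simp
    · refine Finset.sum_congr rfl (fun j _ => ?_)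
      rw [snoc_succAbove, pd_comm _ _ (hs _)]
      simp
  rw [Finset.sum_congr rfl (fun i _ => h1 i), ← Finset.mul_sum, Finset.sum_add_distrib,
    Finset.sum_comm]
  congr 2
  refine Finset.sum_congr rfl (fun j _ => ?_)
  change _ = pd (idx j)
    (fun y => ∑ i : Fin n, pd i (fun y => u y (Fin.snoc (idx ∘ j.succAbove) i)) y) x
  rw [pd_sum _ _ _ (fun i => pd_smooth _ (hs _))]

theorem div_dIter {n m : ℕ} {v : TF n (m + 1)} (hs : SmTF v) (hsym : IsSymTF v)
    (hsol : div' v = fun _ _ => 0) (ℓ : ℕ) :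
    ∃ c : ℝ, (div' (dIter (ℓ + 1) v) : TF n (m + 1 + ℓ)) =
      fun x idx => c * lap (dIter ℓ v) x idx := by
  induction ℓ with
  | zero =>
    refine ⟨((m : ℝ) + 2)⁻¹, ?_⟩
    funext x idx
    refine (div_dsym hs hsym x idx).trans ?_
    simp only [hsol, pd_zero, Finset.sum_const_zero, add_zero]
    rfl
  | succ ℓ ih =>
    obtain ⟨c, hc⟩ := ih
    have hsl := dIter_smooth hs ℓ
    have hyl := dIter_sym hsym ℓ
    refine ⟨(((m + 1 + ℓ : ℕ) : ℝ) + 2)⁻¹ * (1 + c * (((m + 1 + ℓ : ℕ) : ℝ) + 1)), ?_⟩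
    funext x idx
    refine (div_dsym (m := m + 1 + ℓ) (dIter_smooth hs (ℓ + 1)) (dIter_sym hsym (ℓ + 1))
      x idx).trans ?_
    rw [mul_assoc]
    congr 1
    rw [add_mul, one_mul]
    congr 1
    have h2 : lap (dIter (ℓ + 1) v) x idx = (((m + 1 + ℓ : ℕ) : ℝ) + 1)⁻¹ *
        ∑ j, slap (pd (idx j) (fun y => dIter ℓ v y (idx ∘ j.succAbove))) x := by
      rw [lap_eq]
      change slap (fun z => dsym (dIter ℓ v) z idx) x = _
      simp only [dsym_eq hyl]
      rw [slap_mul _ (ContDiff.sum (fun k _ => pd_smooth _ (hsl _))),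
        slap_sum _ _ (fun k => pd_smooth _ (hsl _))]
      rfl
    rw [h2, mul_assoc, ← mul_assoc _ _⁻¹, mul_inv_cancel₀ (by positivity), one_mul,
      Finset.mul_sum]
    refine Finset.sum_congr rfl (fun j _ => ?_)
    have h3 : (fun y => (div' (dIter (ℓ + 1) v) : TF n (m + 1 + ℓ)) y (idx ∘ j.succAbove)) =
        fun y => c * slap (fun z => dIter ℓ v z (idx ∘ j.succAbove)) y := by
      rw [hc]; rfl
    refine (congrArg (fun g => pd (idx j) g x) h3).trans ?_
    rw [pd_mul _ _ (slap_smooth (hsl _)), pd_slap _ (hsl _)]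

/-- If `v` is a solenoidal symmetric tensor field with Schwartz components then
`δ^(ℓ+1) d^ℓ v = 0` for every `ℓ ≥ 0`; in particular `δ^ℓ d^ℓ v` is solenoidal. -/
theorem stmt3 {n m : ℕ} (v : TF n (m + 1)) (hS : IsSchwartzTF v) (hsym : IsSymTF v)
    (hsol : div' v = fun _ _ => 0) (ℓ : ℕ) :
    divIter (ℓ + 1) (dIter ℓ v) = fun _ _ => 0 := by
  have hs : SmTF v := by
    intro idx
    obtain ⟨g, hg⟩ := hS idx
    rw [hg]
    exact g.smooth _
  induction ℓ with
  | zero => exact hsol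
  | succ ℓ ih =>
    obtain ⟨c, hc⟩ := div_dIter hs hsym hsol ℓ
    refine zero_of_heq (by omega) _ _ (divIter_heq (dIter (ℓ + 1) v) (ℓ + 1)) ?_
    refine (congrArg (divIter (ℓ + 1)) hc).trans ?_
    rw [divIter_lap (dIter_smooth hs ℓ), ih]
    funext x idx
    simp [lap, pd_zero]

end
end

section
/- Let f be a Schwartz symmetric m-tensor field on ℝⁿ and ωᵢ a fixed unit vector. Then ∂ᵐ/∂pᵐ [𝒯ᵐ(⟨x, ωᵢ⟩ f)(ω, p)] = R( m·⟨ωᵢ, δ^{m−1} f⟩ + ⟨x, ωᵢ⟩·δᵐ f )(ω, p), where R is the scalar Radon transform and 𝒯ᵐ is the transversal Radon transform. -/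
open MeasureTheory
open scoped RealInnerProductSpace
noncomputable section

def Sch {n : ℕ} (h : E n → ℝ) : Prop := ∃ g : SchwartzMap (E n) ℝ, h = ⇑g

lemma Sch.diff {n : ℕ} {h : E n → ℝ} (hh : Sch h) : Differentiable ℝ h := by
  obtain ⟨g, rfl⟩ := hh
  exact g.differentiable

lemma Sch.cont {n : ℕ} {h : E n → ℝ} (hh : Sch h) : Continuous h := by
  obtain ⟨g, rfl⟩ := hh
  exact g.continuous

lemma Sch.sum {n : ℕ} {ι : Type*} (s : Finset ι) {h : ι → E n → ℝ} (hh : ∀ i, Sch (h i)) :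
    Sch (fun x => ∑ i ∈ s, h i x) := by
  choose g hg using hh
  refine ⟨∑ i ∈ s, g i, ?_⟩
  ext x
  simp [hg]

lemma Sch.add {n : ℕ} {h k : E n → ℝ} (hh : Sch h) (hk : Sch k) : Sch (fun x => h x + k x) := by
  obtain ⟨g, rfl⟩ := hh
  obtain ⟨g', rfl⟩ := hk
  exact ⟨g + g', rfl⟩

lemma Sch.const_mul {n : ℕ} (c : ℝ) {h : E n → ℝ} (hh : Sch h) : Sch (fun x => c * h x) := by
  obtain ⟨g, rfl⟩ := hh
  exact ⟨c • g, rfl⟩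

lemma Sch.fd {n : ℕ} (v : E n) {h : E n → ℝ} (hh : Sch h) : Sch (fun x => fderiv ℝ h x v) := by
  obtain ⟨g, rfl⟩ := hh
  refine ⟨LineDeriv.lineDerivOp v g, ?_⟩
  ext x
  rw [SchwartzMap.lineDerivOp_apply_eq_fderiv]

lemma Sch.inner_mul {n : ℕ} (w : E n) {h : E n → ℝ} (hh : Sch h) :
    Sch (fun x => ⟪x, w⟫ * h x) := by
  obtain ⟨g, rfl⟩ := hh
  refine ⟨SchwartzMap.smulLeftCLM ℝ (fun x : E n => (⟪x, w⟫ : ℝ)) g, ?_⟩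
  ext x
  rw [SchwartzMap.smulLeftCLM_apply_apply (by fun_prop)]
  rfl

lemma norm_le_hyp {n : ℕ} (ω : E n) (q : ℝ) (y : ((ℝ ∙ ω)ᗮ : Submodule ℝ (E n))) :
    ‖y‖ ≤ ‖q • ω + (y : E n)‖ := by
  have h0 : ⟪q • ω, (y : E n)⟫ = (0 : ℝ) := by
    rw [inner_smul_left, (Submodule.mem_orthogonal_singleton_iff_inner_right.1 y.2)]
    simp
  have h1 := norm_add_sq_eq_norm_sq_add_norm_sq_of_inner_eq_zero (q • ω) (y : E n) h0
  have h2 : ‖y‖ = ‖(y : E n)‖ := rfl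
  rw [h2]
  nlinarith [norm_nonneg (q • ω), norm_nonneg (y : E n), norm_nonneg (q • ω + (y : E n))]

/-- Uniform integrable bound on hyperplanes. -/
lemma Sch.bound {n : ℕ} (ω : E n) {h : E n → ℝ} (hh : Sch h) :
    ∃ b : ((ℝ ∙ ω)ᗮ : Submodule ℝ (E n)) → ℝ, Integrable b ∧
      ∀ (q : ℝ) (y : ((ℝ ∙ ω)ᗮ : Submodule ℝ (E n))), ‖h (q • ω + (y : E n))‖ ≤ b y := by
  obtain ⟨g, rfl⟩ := hh
  set V : Submodule ℝ (E n) := (ℝ ∙ ω)ᗮ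
  set k : ℕ := Module.finrank ℝ V + 1 with hk
  set C : ℝ := 2 ^ k * (Finset.Iic (k, 0)).sup (fun m => SchwartzMap.seminorm ℝ m.1 m.2) g with hC
  refine ⟨fun y => C * (1 + ‖y‖) ^ (-(k : ℝ)), ?_, ?_⟩
  · apply Integrable.const_mul
    apply integrable_one_add_norm
    rw [hk]; push_cast; linarith
  · intro q y
    have h1 := SchwartzMap.one_add_le_sup_seminorm_apply (𝕜 := ℝ) (m := (k, 0)) (k := k) (n := 0)
      le_rfl le_rfl g (q • ω + (y : E n))
    rw [norm_iteratedFDeriv_zero] at h1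
    have h2 := norm_le_hyp ω q y
    have h3 : 0 < (1 + ‖y‖) ^ k := by positivity
    beta_reduce
    rw [Real.rpow_neg (by positivity), Real.rpow_natCast, ← div_eq_mul_inv, le_div_iff₀ h3]
    refine le_trans ?_ h1
    rw [mul_comm]
    gcongr

lemma Sch.integrable {n : ℕ} (ω : E n) {h : E n → ℝ} (hh : Sch h) (q : ℝ) :
    Integrable (fun y : ((ℝ ∙ ω)ᗮ : Submodule ℝ (E n)) => h (q • ω + (y : E n))) := by
  obtain ⟨b, hb, hle⟩ := hh.bound ω
  refine hb.mono' ?_ (Filter.Eventually.of_forall fun y => hle q y)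
  have := hh.cont
  exact (by fun_prop : Continuous _).aestronglyMeasurable

lemma hypInt_add {n : ℕ} (ω : E n) {h k : E n → ℝ} (hh : Sch h) (hk : Sch k) (q : ℝ) :
    hypInt (fun x => h x + k x) ω q = hypInt h ω q + hypInt k ω q :=
  integral_add (hh.integrable ω q) (hk.integrable ω q)

lemma hypInt_sum {n : ℕ} (ω : E n) {ι : Type*} (s : Finset ι) {h : ι → E n → ℝ}
    (hh : ∀ i, Sch (h i)) (q : ℝ) :
    hypInt (fun x => ∑ i ∈ s, h i x) ω q = ∑ i ∈ s, hypInt (h i) ω q :=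
  integral_finsetSum _ fun i _ => (hh i).integrable ω q

lemma hypInt_const_mul {n : ℕ} (ω : E n) (c : ℝ) (h : E n → ℝ) (q : ℝ) :
    hypInt (fun x => c * h x) ω q = c * hypInt h ω q :=
  integral_const_mul _ _

lemma hasDerivAt_hypInt {n : ℕ} (ω : E n) {h : E n → ℝ} (hh : Sch h) (q : ℝ) :
    HasDerivAt (fun q => hypInt h ω q) (hypInt (fun x => fderiv ℝ h x ω) ω q) q := by
  obtain ⟨b, hb, hle⟩ := (hh.fd ω).bound ω
  refine (hasDerivAt_integral_of_dominated_loc_of_deriv_le (s := Set.univ) Filter.univ_mem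
    (F := fun q (y : ((ℝ ∙ ω)ᗮ : Submodule ℝ (E n))) => h (q • ω + (y : E n)))
    (F' := fun q (y : ((ℝ ∙ ω)ᗮ : Submodule ℝ (E n))) => fderiv ℝ h (q • ω + (y : E n)) ω)
    (Filter.Eventually.of_forall fun q => (hh.integrable ω q).aestronglyMeasurable)
    (hh.integrable ω q) ((hh.fd ω).integrable ω q).aestronglyMeasurable
    (Filter.Eventually.of_forall fun y q _ => hle q y) hb
    (Filter.Eventually.of_forall fun y q _ => ?_)).2
  have h1 : HasDerivAt (fun q : ℝ => q • ω + (y : E n)) ω q := by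
    simpa using ((hasDerivAt_id q).smul_const ω).add_const (y : E n)
  exact (hh.diff _).hasFDerivAt.comp_hasDerivAt q h1

lemma hypInt_fd_orth {n : ℕ} (ω : E n) {h : E n → ℝ} (hh : Sch h) (q : ℝ)
    (v : ((ℝ ∙ ω)ᗮ : Submodule ℝ (E n))) :
    hypInt (fun x => fderiv ℝ h x v) ω q = 0 := by
  have h1 : ∀ y : ((ℝ ∙ ω)ᗮ : Submodule ℝ (E n)),
      HasFDerivAt (fun y : ((ℝ ∙ ω)ᗮ : Submodule ℝ (E n)) => h (q • ω + (y : E n)))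
        ((fderiv ℝ h (q • ω + (y : E n))).comp ((ℝ ∙ ω)ᗮ).subtypeL) y := by
    intro y
    have h2 : HasFDerivAt (fun y : ((ℝ ∙ ω)ᗮ : Submodule ℝ (E n)) => q • ω + (y : E n))
        ((ℝ ∙ ω)ᗮ).subtypeL y :=
      (((ℝ ∙ ω)ᗮ).subtypeL.hasFDerivAt).const_add _
    exact (hh.diff _).hasFDerivAt.comp y h2
  have h3 : ∀ y : ((ℝ ∙ ω)ᗮ : Submodule ℝ (E n)),
      fderiv ℝ (fun y : ((ℝ ∙ ω)ᗮ : Submodule ℝ (E n)) => h (q • ω + (y : E n))) y v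
        = fderiv ℝ h (q • ω + (y : E n)) v := by
    intro y
    rw [(h1 y).fderiv]; rfl
  have key := integral_mul_fderiv_eq_neg_fderiv_mul_of_integrable (𝕜 := ℝ)
    (μ := (volume : Measure ((ℝ ∙ ω)ᗮ : Submodule ℝ (E n))))
    (f := fun _ => (1 : ℝ))
    (g := fun y : ((ℝ ∙ ω)ᗮ : Submodule ℝ (E n)) => h (q • ω + (y : E n))) (v := v)
    (by simp) (by simpa [h3] using (hh.fd (v : E n)).integrable ω q)
    (by simpa using hh.integrable ω q) (fun _ _ => by fun_prop)
    (fun y _ => (h1 y).differentiableAt)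
  simpa [h3, hypInt] using key

lemma hypInt_pd {n : ℕ} (ω : E n) (hω : ‖ω‖ = 1) {h : E n → ℝ} (hh : Sch h) (q : ℝ) (i : Fin n) :
    hypInt (pd i h) ω q = ω i * hypInt (fun x => fderiv ℝ h x ω) ω q := by
  set e : E n := EuclideanSpace.single i 1 with he
  have hmem : e - ω i • ω ∈ ((ℝ ∙ ω)ᗮ : Submodule ℝ (E n)) := by
    rw [Submodule.mem_orthogonal_singleton_iff_inner_right, inner_sub_right, inner_smul_right,
      real_inner_self_eq_norm_sq, hω, he, EuclideanSpace.inner_single_right]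
    simp
  have h1 : pd i h = fun x => ω i * fderiv ℝ h x ω + fderiv ℝ h x (e - ω i • ω) := by
    ext x
    simp [pd, ← he]
  rw [h1, hypInt_add ω ((hh.fd ω).const_mul _) (hh.fd _), hypInt_const_mul,
    hypInt_fd_orth ω hh q ⟨_, hmem⟩, add_zero]

/-- Full divergence. -/
def Dfull {n : ℕ} : (m : ℕ) → TF n m → E n → ℝ
  | 0, u => fun x => u x Fin.elim0
  | m + 1, u => Dfull m (div' u : TF n m)

lemma div'_succ {n m : ℕ} (u : TF n (m + 1)) (x : E n) (idx : Fin m → Fin n) :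
    (div' u : TF n m) x idx
      = ∑ i : Fin n, pd i (fun y => u y (Fin.snoc (α := fun _ => Fin n) idx i)) x := rfl

lemma jv_succ {n m : ℕ} (w : E n) (u : TF n (m + 1)) (x : E n) (idx : Fin m → Fin n) :
    (jv w u : TF n m) x idx
      = ∑ i : Fin n, w i * u x (Fin.snoc (α := fun _ => Fin n) idx i) := rfl

lemma sch_div {n m : ℕ} {u : TF n (m + 1)} (hu : IsSchwartzTF u) :
    IsSchwartzTF (div' u : TF n m) := fun idx =>
  Sch.sum Finset.univ (h := fun i x => pd i (fun y => u y (Fin.snoc (α := fun _ => Fin n) idx i)) x)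
    fun i => Sch.fd _ (hu _)

lemma sch_jv {n m : ℕ} (w : E n) {u : TF n (m + 1)} (hu : IsSchwartzTF u) :
    IsSchwartzTF (jv w u : TF n m) := fun idx =>
  Sch.sum Finset.univ (h := fun i x => w i * u x (Fin.snoc (α := fun _ => Fin n) idx i))
    fun i => Sch.const_mul _ (hu _)

lemma sch_inner {n m : ℕ} (w : E n) {u : TF n m} (hu : IsSchwartzTF u) :
    IsSchwartzTF (fun x idx => ⟪x, w⟫ * u x idx : TF n m) := fun idx =>
  Sch.inner_mul w (hu idx)

lemma sch_contr {n m : ℕ} (ω : E n) {u : TF n m} (hu : IsSchwartzTF u) :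
    Sch (contr u (fun _ => ω)) :=
  Sch.sum Finset.univ (h := fun (idx : Fin m → Fin n) x => u x idx * ∏ j, ω (idx j)) fun idx => by
    simpa only [mul_comm] using Sch.const_mul (∏ j, ω (idx j)) (hu idx)

lemma hypInt_contr {n m : ℕ} (ω : E n) {u : TF n m} (hu : IsSchwartzTF u) (q : ℝ) :
    hypInt (contr u (fun _ => ω)) ω q
      = ∑ idx : Fin m → Fin n, (∏ j, ω (idx j)) * hypInt (fun x => u x idx) ω q := by
  have : contr u (fun _ => ω)
      = fun x => ∑ idx : Fin m → Fin n, (∏ j, ω (idx j)) * u x idx := by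
    ext x; simp only [contr, mul_comm]
  rw [this, hypInt_sum ω _ (fun idx => Sch.const_mul _ (hu idx))]
  simp only [hypInt_const_mul]

lemma sum_snoc {n m : ℕ} (F : (Fin (m + 1) → Fin n) → ℝ) :
    ∑ idx, F idx = ∑ idx : Fin m → Fin n, ∑ i, F (Fin.snoc (α := fun _ => Fin n) idx i) := by
  rw [← (Fin.snocEquiv (fun _ => Fin n)).sum_comp F, Fintype.sum_prod_type, Finset.sum_comm]
  rfl

lemma deriv_TRT {n m : ℕ} (ω : E n) (hω : ‖ω‖ = 1) {u : TF n (m + 1)} (hu : IsSchwartzTF u) :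
    deriv (fun q => TRT u ω q) = fun q => TRT (div' u : TF n m) ω q := by
  ext q
  have h1 : (fun q => TRT u ω q) = fun q => ∑ idx : Fin (m + 1) → Fin n,
      (∏ j, ω (idx j)) * hypInt (fun x => u x idx) ω q := by
    ext q; exact hypInt_contr ω hu q
  rw [h1]
  have h2 := HasDerivAt.fun_sum (u := Finset.univ) (x := q) fun (idx : Fin (m + 1) → Fin n) _ =>
    (hasDerivAt_hypInt ω (hu idx) q).const_mul (∏ j, ω (idx j))
  rw [h2.deriv, sum_snoc, TRT, hypInt_contr ω (sch_div hu)]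
  refine Finset.sum_congr rfl fun idx _ => ?_
  have h3 : (fun x => (div' u : TF n m) x idx) = fun x => ∑ i : Fin n,
      pd i (fun y => u y (Fin.snoc (α := fun _ => Fin n) idx i)) x := rfl
  rw [h3, hypInt_sum ω Finset.univ
    (h := fun i x => pd i (fun y => u y (Fin.snoc (α := fun _ => Fin n) idx i)) x)
    (fun i => Sch.fd _ (hu _)), Finset.mul_sum]
  refine Finset.sum_congr rfl fun i _ => ?_
  have := hypInt_pd ω hω (hu (Fin.snoc (α := fun _ => Fin n) idx i)) q i
  rw [this, Fin.prod_univ_castSucc]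
  simp only [Fin.snoc_castSucc, Fin.snoc_last]
  exact mul_assoc _ _ _

lemma iter_TRT {n : ℕ} (ω : E n) (hω : ‖ω‖ = 1) : ∀ (m : ℕ) {u : TF n m}, IsSchwartzTF u →
    iteratedDeriv m (fun q => TRT u ω q) = fun q => hypInt (Dfull m u) ω q
  | 0, u, hu => by
    ext q
    rw [iteratedDeriv_zero, TRT, hypInt_contr ω hu]
    simp [Dfull, Subsingleton.elim (default : Fin 0 → Fin n) Fin.elim0]
  | m + 1, u, hu => by
    rw [iteratedDeriv_succ', deriv_TRT ω hω hu, iter_TRT ω hω m (sch_div hu)]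
    rfl

/-- Leibniz rule for one divergence. -/
lemma div_inner {n m : ℕ} (w : E n) {u : TF n (m + 1)} (hu : IsSchwartzTF u) :
    (div' (fun x idx => ⟪x, w⟫ * u x idx : TF n (m + 1)) : TF n m)
      = fun x idx => ⟪x, w⟫ * (div' u : TF n m) x idx + (jv w u : TF n m) x idx := by
  ext x idx
  rw [div'_succ, div'_succ, jv_succ, Finset.mul_sum, ← Finset.sum_add_distrib]
  refine Finset.sum_congr rfl fun i _ => ?_
  have h1 : HasFDerivAt (fun y : E n => (⟪y, w⟫ : ℝ)) (innerSL ℝ w) x := by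
    have := (innerSL ℝ w).hasFDerivAt (x := x)
    simpa [real_inner_comm] using this
  have h2 := (Sch.diff (hu (Fin.snoc (α := fun _ => Fin n) idx i)) x).hasFDerivAt
  simp only [pd]
  rw [(h1.fun_mul h2).fderiv]
  simp [EuclideanSpace.inner_single_right]
  ring

lemma div_add {n m : ℕ} {u v : TF n (m + 1)} (hu : IsSchwartzTF u) (hv : IsSchwartzTF v) :
    (div' (fun x idx => u x idx + v x idx : TF n (m + 1)) : TF n m)
      = fun x idx => (div' u : TF n m) x idx + (div' v : TF n m) x idx := by
  ext x idx
  simp only [div'_succ, ← Finset.sum_add_distrib]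
  refine Finset.sum_congr rfl fun i _ => ?_
  simp only [pd]
  rw [fderiv_fun_add (Sch.diff (hu _) x) (Sch.diff (hv _) x)]
  rfl

lemma Dfull_add {n : ℕ} : ∀ (m : ℕ) {u v : TF n m}, IsSchwartzTF u → IsSchwartzTF v → ∀ x,
    Dfull m (fun x idx => u x idx + v x idx) x = Dfull m u x + Dfull m v x
  | 0, _, _, _, _, _ => rfl
  | m + 1, u, v, hu, hv, x => by
    simp only [Dfull]
    rw [div_add hu hv]
    exact Dfull_add m (sch_div hu) (sch_div hv) x

lemma sym_div {n m : ℕ} {u : TF n (m + 1)} (hu : IsSymTF u) : IsSymTF (div' u : TF n m) := by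
  intro x σ idx
  simp only [div'_succ]
  refine Finset.sum_congr rfl fun i _ => ?_
  congr 1
  ext y
  set τ : Equiv.Perm (Fin (m + 1)) :=
    (finSuccEquivLast.trans (Equiv.optionCongr σ)).trans finSuccEquivLast.symm with hτ
  rw [← hu y τ (Fin.snoc (α := fun _ => Fin n) idx i)]
  congr 1
  ext j
  refine Fin.lastCases ?_ (fun j => ?_) j <;> simp [hτ]

lemma div_jv {n m : ℕ} (w : E n) {u : TF n (m + 2)} (hS : IsSchwartzTF u) (hu : IsSymTF u) :
    (div' (jv w u : TF n (m + 1)) : TF n m) = (jv w (div' u : TF n (m + 1)) : TF n m) := by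
  ext x idx
  have hswap : ∀ (y : E n) (i j : Fin n),
      u y (Fin.snoc (α := fun _ => Fin n) (Fin.snoc (α := fun _ => Fin n) idx i) j)
        = u y (Fin.snoc (α := fun _ => Fin n) (Fin.snoc (α := fun _ => Fin n) idx j) i) := by
    intro y i j
    rw [← hu y (Equiv.swap (Fin.last (m + 1)) (Fin.castSucc (Fin.last m)))]
    congr 1
    ext k
    refine Fin.lastCases ?_ (fun k => ?_) k
    · simp
    · refine Fin.lastCases ?_ (fun k => ?_) k
      · simp
      · have h1 : (Fin.castSucc (Fin.castSucc k)) ≠ Fin.last (m + 1) := Fin.castSucc_ne_last _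
        have h2 : (Fin.castSucc (Fin.castSucc k)) ≠ Fin.castSucc (Fin.last m) := fun h =>
          Fin.castSucc_ne_last k (Fin.castSucc_injective _ h)
        simp [Equiv.swap_apply_of_ne_of_ne h1 h2]
  have h1 : ∀ i : Fin n, pd i (fun y => (jv w u : TF n (m + 1)) y
      (Fin.snoc (α := fun _ => Fin n) idx i)) x
      = ∑ j : Fin n, w j * pd i (fun y =>
        u y (Fin.snoc (α := fun _ => Fin n) (Fin.snoc (α := fun _ => Fin n) idx j) i)) x := by
    intro i
    have h2 : (fun y => (jv w u : TF n (m + 1)) y (Fin.snoc (α := fun _ => Fin n) idx i))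
        = fun y => ∑ j : Fin n, w j *
          u y (Fin.snoc (α := fun _ => Fin n) (Fin.snoc (α := fun _ => Fin n) idx j) i) := by
      ext y
      rw [jv_succ]
      simp only [hswap y i]
    have h3 := HasFDerivAt.fun_sum (u := Finset.univ) (x := x) fun (j : Fin n) _ =>
      (Sch.diff (hS (Fin.snoc (α := fun _ => Fin n)
        (Fin.snoc (α := fun _ => Fin n) idx j) i)) x).hasFDerivAt.const_mul (w j)
    rw [h2]
    unfold pd
    rw [h3.fderiv]
    simp
  rw [div'_succ, jv_succ]
  simp only [h1, div'_succ, Finset.mul_sum]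
  rw [Finset.sum_comm]

lemma Dfull_inner {n : ℕ} (w : E n) : ∀ (m : ℕ) {u : TF n (m + 1)}, IsSchwartzTF u → IsSymTF u →
    ∀ x, Dfull (m + 1) (fun x idx => ⟪x, w⟫ * u x idx) x
      = ⟪x, w⟫ * Dfull (m + 1) u x + ((m : ℝ) + 1) * Dfull m (jv w u : TF n m) x
  | 0, u, hS, hu, x => by
    simp only [Dfull]
    rw [div_inner w hS]
    simp
  | m + 1, u, hS, hu, x => by
    have h1 := Dfull_add (m + 1) (sch_inner w (sch_div hS)) (sch_jv w hS) x
    have h2 := Dfull_inner w m (sch_div hS) (sym_div hu) x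
    rw [← div_jv w hS hu] at h2
    rw [Dfull, div_inner w hS]
    refine h1.trans ?_
    refine (congrArg (· + _) h2).trans ?_
    simp only [Dfull]
    push_cast
    ring

lemma heq_div {n a b : ℕ} (h : a = b) {u : TF n a} {v : TF n b} (huv : HEq u v) :
    HEq (div' u) (div' v) := by
  subst h; rw [eq_of_heq huv]

lemma heq_jv {n a b : ℕ} (w : E n) (h : a = b) {u : TF n a} {v : TF n b} (huv : HEq u v) :
    HEq (jv w u) (jv w v) := by
  subst h; rw [eq_of_heq huv]

lemma heq_eval {n a b : ℕ} (h : a = b) (hb : b = 0) {u : TF n a} {v : TF n b} (huv : HEq u v)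
    (x : E n) (i : Fin a → Fin n) (j : Fin b → Fin n) : u x i = v x j := by
  subst h; subst hb; rw [eq_of_heq huv, Subsingleton.elim i j]

lemma heq_iter {n m : ℕ} (u : TF n (m + 1)) : ∀ k : ℕ,
    HEq (divIter (k + 1) u) (divIter k (div' u : TF n m))
  | 0 => HEq.rfl
  | k + 1 => heq_div (show m + 1 - (k + 1) = m - k by omega) (heq_iter u k)

lemma divIter_full {n : ℕ} : ∀ (m : ℕ) (u : TF n m) (x : E n) (idx : Fin (m - m) → Fin n),
    divIter m u x idx = Dfull m u x
  | 0, u, x, idx => by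
    simp only [Dfull]
    rw [Subsingleton.elim (α := Fin 0 → Fin n) Fin.elim0 idx]
    rfl
  | m + 1, u, x, idx => by
    rw [Dfull, ← divIter_full m (div' u : TF n m) x (fun j => Fin.elim0 (Fin.cast (by omega) j))]
    exact heq_eval (by omega) (by omega) (heq_iter u m) x _ _

lemma jv_divIter {n : ℕ} (w : E n) : ∀ (m : ℕ) (u : TF n (m + 1)), IsSchwartzTF u → IsSymTF u →
    ∀ (x : E n) (idx : Fin (m + 1 - m - 1) → Fin n),
    jv w (divIter m u) x idx = Dfull m (jv w u : TF n m) x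
  | 0, u, _, _, x, idx => by
    simp only [Dfull]
    rw [Subsingleton.elim (α := Fin 0 → Fin n) Fin.elim0 idx]
    rfl
  | m + 1, u, hS, hu, x, idx => by
    rw [Dfull, div_jv w hS hu, ← jv_divIter w m (div' u : TF n (m + 1)) (sch_div hS) (sym_div hu) x
      (fun j => Fin.elim0 (Fin.cast (by omega) j))]
    exact heq_eval (by omega) (by omega) (heq_jv w (by omega) (heq_iter u m)) x _ _

/-- `∂^m/∂p^m [𝒯^m(⟨x, ωᵢ⟩ f)(ω, p)] = R(m ⟨ωᵢ, δ^{m-1} f⟩ + ⟨x, ωᵢ⟩ δ^m f)(ω, p)`. -/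
theorem stmt17 {n m : ℕ} (hm : 1 ≤ m) (f : TF n m)
    (hS : IsSchwartzTF f) (hsym : IsSymTF f)
    (w : E n) (hw : ‖w‖ = 1) (ω : E n) (hω : ‖ω‖ = 1) (p : ℝ) :
    iteratedDeriv m (fun q => TRT (fun x idx => ⟪x, w⟫ * f x idx) ω q) p
      = hypInt (fun x =>
          (m : ℝ) * jv w (divIter (m - 1) f) x
              (fun j => Fin.elim0 (Fin.cast (by omega : m - (m - 1) - 1 = 0) j))
            + ⟪x, w⟫ * divIter m f x
                (fun j => Fin.elim0 (Fin.cast (by omega : m - m = 0) j))) ω p := by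
  obtain ⟨m, rfl⟩ : ∃ k, m = k + 1 := ⟨m - 1, by omega⟩
  rw [iter_TRT ω hω (m + 1) (sch_inner w hS)]
  simp only
  congr 1
  ext x
  rw [Dfull_inner w m hS hsym, divIter_full]
  have := jv_divIter w m f hS hsym x
    (fun j => Fin.elim0 (Fin.cast (by omega : m + 1 - m - 1 = 0) j))
  rw [← this, add_comm]
  push_cast
  rfl

end
end
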